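/- (Four invariants of entropy solutions.) For every t > 0: limsup_{x→−∞} (1/x)·∫₀ˣ u⁺(ξ,t) dξ = limsup_{x→−∞} (1/x)·∫₀ˣ φ(ξ) dξ; liminf_{x→−∞} (1/x)·∫₀ˣ u⁺(ξ,t) dξ = liminf_{x→−∞} (1/x)·∫₀ˣ φ(ξ) dξ; limsup_{x→+∞} (1/x)·∫₀ˣ u⁺(ξ,t) dξ = limsup_{x→+∞} (1/x)·∫₀ˣ φ(ξ) dξ; and liminf_{x→+∞} (1/x)·∫₀ˣ u⁺(ξ,t) dξ = liminf_{x→+∞} (1/x)·∫₀ˣ φ(ξ) dξ. The same four identities hold with u⁻ in place of u⁺. -/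

import Mathlib

open MeasureTheory Filter Set

noncomputable def eFun (f φ : ℝ → ℝ) (u x t : ℝ) : ℝ :=
  t * (∫ s in (0:ℝ)..u, deriv (deriv f) s * (φ (x - t * deriv f s) - s))

def maxSet (f φ : ℝ → ℝ) (x t : ℝ) : Set ℝ :=
  {w : ℝ | ∀ v : ℝ, eFun f φ v x t ≤ eFun f φ w x t}

noncomputable def uPlus (f φ : ℝ → ℝ) (x t : ℝ) : ℝ := sInf (maxSet f φ x t)

noncomputable def uMinus (f φ : ℝ → ℝ) (x t : ℝ) : ℝ := sSup (maxSet f φ x t)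

open scoped Topology

theorem strictMono_deriv_of_null_zeros {f : ℝ → ℝ} (hf : ContDiff ℝ 2 f)
    (hconv : ∀ u, 0 ≤ deriv (deriv f) u)
    (hdeg : volume {u : ℝ | deriv (deriv f) u = 0} = 0) : StrictMono (deriv f) := by
  have hd : Differentiable ℝ (deriv f) :=
    ((contDiff_succ_iff_deriv (n := 1)).1 hf).2.2.differentiable one_ne_zero
  have hm : Monotone (deriv f) := monotone_of_deriv_nonneg hd hconv
  refine hm.strictMono_of_injective ?_
  have key : ∀ a b, a < b → deriv f a ≠ deriv f b := by
    intro a b hab h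
    have hsub : Ioo a b ⊆ {u : ℝ | deriv (deriv f) u = 0} := by
      intro u hu
      have hEq : deriv f =ᶠ[𝓝 u] fun _ => deriv f a := by
        filter_upwards [Ioo_mem_nhds hu.1 hu.2] with v hv
        exact le_antisymm ((hm hv.2.le).trans h.ge) (hm hv.1.le)
      simpa using hEq.deriv_eq
    have h0 := measure_mono_null hsub hdeg
    rw [Real.volume_Ioo, ENNReal.ofReal_eq_zero] at h0
    linarith
  intro a b h
  by_contra hne
  rcases lt_or_gt_of_ne hne with hlt | hlt
  · exact key a b hlt h
  · exact key b a hlt h.symm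

theorem tangent_lt_of_strictMono_deriv {f : ℝ → ℝ} (hd : Differentiable ℝ f)
    (hg : StrictMono (deriv f)) {v w : ℝ} (hvw : v ≠ w) :
    f w + deriv f w * (v - w) < f v := by
  rcases lt_or_gt_of_ne hvw with h | h
  · obtain ⟨c, hc, hc'⟩ := exists_deriv_eq_slope f h hd.continuous.continuousOn hd.differentiableOn
    have := hg hc.2
    rw [eq_div_iff (by linarith)] at hc'
    nlinarith
  · obtain ⟨c, hc, hc'⟩ := exists_deriv_eq_slope f h hd.continuous.continuousOn hd.differentiableOn
    have := hg hc.1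
    rw [eq_div_iff (by linarith)] at hc'
    nlinarith

/-- The Hopf-Lax type cost, whose minimizers in `u` are the maximizers of `eFun`. -/
noncomputable def hopfCost (f φ : ℝ → ℝ) (t u x : ℝ) : ℝ :=
  (∫ ξ in (0:ℝ)..(x - t * deriv f u), φ ξ) + t * (u * deriv f u - f u)

section

variable {f φ : ℝ → ℝ} {M t : ℝ}

theorem intervalIntegrable_of_bounded (hφmeas : Measurable φ) (hφbdd : ∀ x, |φ x| ≤ M) (a b : ℝ) :
    IntervalIntegrable φ volume a b :=
  (intervalIntegrable_const (c := M)).mono_fun' hφmeas.aestronglyMeasurable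
    (Eventually.of_forall hφbdd)

theorem abs_integral_sub_le_of_bounded (hφmeas : Measurable φ) (hφbdd : ∀ x, |φ x| ≤ M)
    (a b : ℝ) :
    |(∫ ξ in (0:ℝ)..b, φ ξ) - ∫ ξ in (0:ℝ)..a, φ ξ| ≤ M * |b - a| := by
  rw [intervalIntegral.integral_interval_sub_left
    (intervalIntegrable_of_bounded hφmeas hφbdd _ _)
    (intervalIntegrable_of_bounded hφmeas hφbdd _ _)]
  exact intervalIntegral.norm_integral_le_of_norm_le_const (f := φ) fun x _ => hφbdd x

theorem eFun_eq_hopfCost_sub (hf : ContDiff ℝ 2 f) (hconv : ∀ u, 0 ≤ deriv (deriv f) u)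
    (hφmeas : Measurable φ) (hφbdd : ∀ x, |φ x| ≤ M) (ht : 0 < t) (u x : ℝ) :
    eFun f φ u x t = hopfCost f φ t 0 x - hopfCost f φ t u x := by
  have hg : ContDiff ℝ 1 (deriv f) := ((contDiff_succ_iff_deriv (n := 1)).1 hf).2.2
  have hgd : Differentiable ℝ (deriv f) := hg.differentiable one_ne_zero
  have hfd : Differentiable ℝ f := hf.differentiable two_ne_zero
  have hg'c : Continuous (deriv (deriv f)) := hg.continuous_deriv le_rfl
  have hsubst := intervalIntegral.integral_comp_mul_deriv_of_deriv_nonpos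
    (a := 0) (b := u) (f := fun s => x - t * deriv f s) (f' := fun s => -(t * deriv (deriv f) s))
    (g := φ) (continuous_const.sub (continuous_const.mul hgd.continuous)).continuousOn
    (fun s _ => by
      simpa using ((hgd s).hasDerivAt.const_mul t).const_sub x)
    (fun s _ => by have := mul_nonneg ht.le (hconv s); linarith)
  have hintId : IntervalIntegrable (fun s => deriv (deriv f) s * s) volume 0 u :=
    (hg'c.mul continuous_id).intervalIntegrable _ _
  have hparts : ∫ s in (0:ℝ)..u, deriv (deriv f) s * s
      = (u * deriv f u - f u) - (0 * deriv f 0 - f 0) := by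
    refine intervalIntegral.integral_eq_sub_of_hasDerivAt
      (f := fun s => s * deriv f s - f s) (fun s _ => ?_) ?_
    · have := ((hasDerivAt_id s).mul (hgd s).hasDerivAt).sub (hfd s).hasDerivAt
      exact this.congr_deriv (by simp only [id]; ring)
    · exact hintId
  have hintComp : IntervalIntegrable (fun s => deriv (deriv f) s * φ (x - t * deriv f s))
      volume 0 u := by
    have h1 : IntervalIntegrable (fun s => φ (x - t * deriv f s)) volume 0 u :=
      intervalIntegrable_of_bounded (hφmeas.comp (by fun_prop)) (fun s => hφbdd _) _ _
    exact h1.continuousOn_mul hg'c.continuousOn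
  have hsplit : ∫ s in (0:ℝ)..u, deriv (deriv f) s * (φ (x - t * deriv f s) - s)
      = (∫ s in (0:ℝ)..u, deriv (deriv f) s * φ (x - t * deriv f s))
        - ∫ s in (0:ℝ)..u, deriv (deriv f) s * s := by
    rw [← intervalIntegral.integral_sub hintComp hintId]
    simp only [mul_sub]
  have h2 : t * (∫ s in (0:ℝ)..u, deriv (deriv f) s * φ (x - t * deriv f s))
      = -∫ s in (0:ℝ)..u, (φ ∘ fun s => x - t * deriv f s) s * -(t * deriv (deriv f) s) := by
    rw [← intervalIntegral.integral_const_mul, ← intervalIntegral.integral_neg]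
    congr 1
    ext s
    simp only [Function.comp]
    ring
  have h3 := intervalIntegral.integral_interval_sub_left
    (intervalIntegrable_of_bounded hφmeas hφbdd 0 (x - t * deriv f u))
    (intervalIntegrable_of_bounded hφmeas hφbdd 0 (x - t * deriv f 0))
  rw [eFun, hsplit, mul_sub, h2, hsubst, hparts, hopfCost, hopfCost, ← h3]
  ring

theorem mem_maxSet_iff_hopfCost_le (hf : ContDiff ℝ 2 f) (hconv : ∀ u, 0 ≤ deriv (deriv f) u)
    (hφmeas : Measurable φ) (hφbdd : ∀ x, |φ x| ≤ M) (ht : 0 < t) (w x : ℝ) :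
    w ∈ maxSet f φ x t ↔ ∀ v, hopfCost f φ t w x ≤ hopfCost f φ t v x := by
  simp only [maxSet, mem_ofPred_eq, eFun_eq_hopfCost_sub hf hconv hφmeas hφbdd ht,
    sub_le_sub_iff_left]

theorem continuous_hopfCost (hf : ContDiff ℝ 2 f) (hφmeas : Measurable φ)
    (hφbdd : ∀ x, |φ x| ≤ M) (x : ℝ) : Continuous fun u => hopfCost f φ t u x := by
  have hg : Continuous (deriv f) := hf.continuous_deriv one_le_two
  have hfc : Continuous f := hf.continuous
  have hP : Continuous fun y => ∫ ξ in (0:ℝ)..y, φ ξ :=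
    intervalIntegral.continuous_primitive (intervalIntegrable_of_bounded hφmeas hφbdd) 0
  unfold hopfCost
  fun_prop

theorem hopfCost_lt_of_gt (hf : ContDiff ℝ 2 f) (hmono : StrictMono (deriv f))
    (hφmeas : Measurable φ) (hφbdd : ∀ x, |φ x| ≤ M) (ht : 0 < t) {u : ℝ} (hu : M < u) (x : ℝ) :
    hopfCost f φ t M x < hopfCost f φ t u x := by
  have h1 := abs_integral_sub_le_of_bounded hφmeas hφbdd (x - t * deriv f M) (x - t * deriv f u)
  have h2 := tangent_lt_of_strictMono_deriv (hf.differentiable two_ne_zero) hmono hu.ne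
  have h3 := mul_pos ht (sub_pos.2 h2)
  have h4 := mul_pos ht (sub_pos.2 (hmono hu))
  rw [show x - t * deriv f u - (x - t * deriv f M) = -(t * (deriv f u - deriv f M)) by ring,
    abs_neg, abs_of_pos h4] at h1
  have h5 := (abs_le.1 h1).1
  unfold hopfCost
  nlinarith

theorem hopfCost_lt_of_lt (hf : ContDiff ℝ 2 f) (hmono : StrictMono (deriv f))
    (hφmeas : Measurable φ) (hφbdd : ∀ x, |φ x| ≤ M) (ht : 0 < t) {u : ℝ} (hu : u < -M) (x : ℝ) :
    hopfCost f φ t (-M) x < hopfCost f φ t u x := by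
  have h1 := abs_integral_sub_le_of_bounded hφmeas hφbdd
    (x - t * deriv f (-M)) (x - t * deriv f u)
  have h2 := tangent_lt_of_strictMono_deriv (hf.differentiable two_ne_zero) hmono hu.ne'
  have h3 := mul_pos ht (sub_pos.2 h2)
  have h4 := mul_pos ht (sub_pos.2 (hmono hu))
  rw [show x - t * deriv f u - (x - t * deriv f (-M)) = t * (deriv f (-M) - deriv f u) by ring,
    abs_of_pos h4] at h1
  have h5 := (abs_le.1 h1).1
  unfold hopfCost
  nlinarith

theorem maxSet_subset_Icc (hf : ContDiff ℝ 2 f) (hconv : ∀ u, 0 ≤ deriv (deriv f) u)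
    (hmono : StrictMono (deriv f)) (hφmeas : Measurable φ) (hφbdd : ∀ x, |φ x| ≤ M)
    (ht : 0 < t) (x : ℝ) : maxSet f φ x t ⊆ Icc (-M) M := by
  intro w hw
  rw [mem_maxSet_iff_hopfCost_le hf hconv hφmeas hφbdd ht] at hw
  constructor
  · by_contra! h
    exact (hw (-M)).not_gt (hopfCost_lt_of_lt hf hmono hφmeas hφbdd ht h x)
  · by_contra! h
    exact (hw M).not_gt (hopfCost_lt_of_gt hf hmono hφmeas hφbdd ht h x)

theorem maxSet_nonempty (hf : ContDiff ℝ 2 f) (hconv : ∀ u, 0 ≤ deriv (deriv f) u)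
    (hmono : StrictMono (deriv f)) (hφmeas : Measurable φ) (hφbdd : ∀ x, |φ x| ≤ M)
    (ht : 0 < t) (x : ℝ) : (maxSet f φ x t).Nonempty := by
  have hM : 0 ≤ M := (abs_nonneg _).trans (hφbdd 0)
  obtain ⟨w, -, hw⟩ := isCompact_Icc.exists_isMinOn (nonempty_Icc.2 (by linarith : -M ≤ M))
    (continuous_hopfCost (t := t) hf hφmeas hφbdd x).continuousOn
  refine ⟨w, (mem_maxSet_iff_hopfCost_le hf hconv hφmeas hφbdd ht w x).2 fun v => ?_⟩
  rcases lt_or_ge v (-M) with h | h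
  · exact (hw (left_mem_Icc.2 (by linarith))).trans
      (hopfCost_lt_of_lt hf hmono hφmeas hφbdd ht h x).le
  rcases lt_or_ge M v with h' | h'
  · exact (hw (right_mem_Icc.2 (by linarith))).trans
      (hopfCost_lt_of_gt hf hmono hφmeas hφbdd ht h' x).le
  exact hw ⟨h, h'⟩

theorem isCompact_maxSet (hf : ContDiff ℝ 2 f) (hconv : ∀ u, 0 ≤ deriv (deriv f) u)
    (hmono : StrictMono (deriv f)) (hφmeas : Measurable φ) (hφbdd : ∀ x, |φ x| ≤ M)
    (ht : 0 < t) (x : ℝ) : IsCompact (maxSet f φ x t) := by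
  refine isCompact_Icc.of_isClosed_subset ?_ (maxSet_subset_Icc hf hconv hmono hφmeas hφbdd ht x)
  have : maxSet f φ x t = ⋂ v, {w | hopfCost f φ t w x ≤ hopfCost f φ t v x} := by
    ext w
    simp [mem_maxSet_iff_hopfCost_le hf hconv hφmeas hφbdd ht]
  rw [this]
  exact isClosed_iInter fun v =>
    isClosed_le (continuous_hopfCost hf hφmeas hφbdd x) continuous_const

/-- The value function `x ↦ min_u hopfCost f φ t u x`. -/
noncomputable def hopfValue (f φ : ℝ → ℝ) (t x : ℝ) : ℝ := hopfCost f φ t (uPlus f φ x t) x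

theorem hopfValue_le_hopfCost (hf : ContDiff ℝ 2 f) (hconv : ∀ u, 0 ≤ deriv (deriv f) u)
    (hmono : StrictMono (deriv f)) (hφmeas : Measurable φ) (hφbdd : ∀ x, |φ x| ≤ M)
    (ht : 0 < t) (v x : ℝ) : hopfValue f φ t x ≤ hopfCost f φ t v x :=
  (mem_maxSet_iff_hopfCost_le hf hconv hφmeas hφbdd ht _ _).1
    ((isCompact_maxSet hf hconv hmono hφmeas hφbdd ht x).sInf_mem
      (maxSet_nonempty hf hconv hmono hφmeas hφbdd ht x)) v

theorem hopfValue_lipschitz (hf : ContDiff ℝ 2 f) (hconv : ∀ u, 0 ≤ deriv (deriv f) u)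
    (hmono : StrictMono (deriv f)) (hφmeas : Measurable φ) (hφbdd : ∀ x, |φ x| ≤ M)
    (ht : 0 < t) : LipschitzWith M.toNNReal (hopfValue f φ t) := by
  refine LipschitzWith.of_le_add_mul' M fun x y => ?_
  refine (hopfValue_le_hopfCost hf hconv hmono hφmeas hφbdd ht (uPlus f φ y t) x).trans ?_
  have h := abs_integral_sub_le_of_bounded hφmeas hφbdd
    (y - t * deriv f (uPlus f φ y t)) (x - t * deriv f (uPlus f φ y t))
  rw [sub_sub_sub_cancel_right] at h
  have := (abs_le.1 h).2
  rw [hopfValue, hopfCost, hopfCost, Real.dist_eq]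
  linarith

theorem hopfValue_sub_le (hf : ContDiff ℝ 2 f) (hconv : ∀ u, 0 ≤ deriv (deriv f) u)
    (hmono : StrictMono (deriv f)) (hφmeas : Measurable φ) (hφbdd : ∀ x, |φ x| ≤ M)
    (ht : 0 < t) {w x : ℝ} (hw : w ∈ maxSet f φ x t) (v : ℝ) :
    hopfValue f φ t (x + t * (deriv f v - deriv f w)) - hopfValue f φ t x
      ≤ v * (t * (deriv f v - deriv f w)) := by
  have h1 := hopfValue_le_hopfCost hf hconv hmono hφmeas hφbdd ht v
    (x + t * (deriv f v - deriv f w))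
  have h2 : hopfCost f φ t w x ≤ hopfValue f φ t x :=
    (mem_maxSet_iff_hopfCost_le hf hconv hφmeas hφbdd ht w x).1 hw _
  have h3 : f w + deriv f w * (v - w) ≤ f v := by
    rcases eq_or_ne v w with rfl | hvw
    · simp
    · exact (tangent_lt_of_strictMono_deriv (hf.differentiable two_ne_zero) hmono hvw).le
  have h4 := mul_le_mul_of_nonneg_left h3 ht.le
  unfold hopfCost at h1 h2
  rw [show x + t * (deriv f v - deriv f w) - t * deriv f v = x - t * deriv f w by ring] at h1
  linarith

theorem hopfValue_deriv_eq (hf : ContDiff ℝ 2 f) (hconv : ∀ u, 0 ≤ deriv (deriv f) u)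
    (hmono : StrictMono (deriv f)) (hφmeas : Measurable φ) (hφbdd : ∀ x, |φ x| ≤ M)
    (ht : 0 < t) {w x : ℝ} (hw : w ∈ maxSet f φ x t)
    (hdiff : DifferentiableAt ℝ (hopfValue f φ t) x) :
    deriv (hopfValue f φ t) x = w := by
  have hslope := hasDerivAt_iff_tendsto_slope_zero.1 hdiff.hasDerivAt
  have hgc : Continuous (deriv f) := hf.continuous_deriv one_le_two
  have hshift : Tendsto (fun v => t * (deriv f v - deriv f w)) (𝓝[≠] w) (𝓝[≠] 0) := by
    refine tendsto_nhdsWithin_iff.2 ⟨?_, ?_⟩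
    · have : Continuous fun v => t * (deriv f v - deriv f w) := by fun_prop
      exact (this.tendsto' w 0 (by simp)).mono_left nhdsWithin_le_nhds
    · filter_upwards [self_mem_nhdsWithin] with v hv
      exact mul_ne_zero ht.ne' (sub_ne_zero.2 (hmono.injective.ne hv))
  have hlim := hslope.comp hshift
  have hle := hopfValue_sub_le hf hconv hmono hφmeas hφbdd ht hw
  apply le_antisymm
  · refine le_of_tendsto_of_tendsto (hlim.mono_left (nhdsGT_le_nhdsNE w))
      (tendsto_id.mono_left nhdsWithin_le_nhds) ?_
    filter_upwards [self_mem_nhdsWithin] with v hv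
    have hpos := mul_pos ht (sub_pos.2 (hmono hv))
    simp only [Function.comp, smul_eq_mul, id]
    rw [inv_mul_le_iff₀ hpos, mul_comm _ v]
    exact hle v
  · refine le_of_tendsto_of_tendsto (tendsto_id.mono_left nhdsWithin_le_nhds)
      (hlim.mono_left (nhdsLT_le_nhdsNE w)) ?_
    filter_upwards [self_mem_nhdsWithin] with v hv
    have hneg : t * (deriv f v - deriv f w) < 0 :=
      mul_neg_of_pos_of_neg ht (sub_neg.2 (hmono hv))
    simp only [Function.comp, smul_eq_mul, id]
    rw [inv_mul_eq_div, le_div_iff_of_neg hneg]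
    exact hle v

theorem integral_maximizer_eq_hopfValue_sub (hf : ContDiff ℝ 2 f)
    (hconv : ∀ u, 0 ≤ deriv (deriv f) u)
    (hmono : StrictMono (deriv f)) (hφmeas : Measurable φ) (hφbdd : ∀ x, |φ x| ≤ M)
    (ht : 0 < t) {w : ℝ → ℝ} (hw : ∀ x, w x ∈ maxSet f φ x t) (x : ℝ) :
    ∫ ξ in (0:ℝ)..x, w ξ = hopfValue f φ t x - hopfValue f φ t 0 := by
  have hL := hopfValue_lipschitz hf hconv hmono hφmeas hφbdd ht
  rw [← (hL.lipschitzOnWith (s := uIcc 0 x)).absolutelyContinuousOnInterval.integral_deriv_eq_sub]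
  refine intervalIntegral.integral_congr_ae ?_
  filter_upwards [hL.ae_differentiableAt_real] with ξ hξ _
  exact (hopfValue_deriv_eq hf hconv hmono hφmeas hφbdd ht (hw ξ) hξ).symm

theorem exists_abs_hopfValue_sub_integral_le (hf : ContDiff ℝ 2 f)
    (hconv : ∀ u, 0 ≤ deriv (deriv f) u)
    (hmono : StrictMono (deriv f)) (hφmeas : Measurable φ) (hφbdd : ∀ x, |φ x| ≤ M)
    (ht : 0 < t) : ∃ C, ∀ x, |hopfValue f φ t x - ∫ ξ in (0:ℝ)..x, φ ξ| ≤ C := by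
  have hg : Continuous (deriv f) := hf.continuous_deriv one_le_two
  have hfc : Continuous f := hf.continuous
  obtain ⟨C, hC⟩ := (isCompact_Icc (a := -M) (b := M)).exists_bound_of_continuousOn
    (f := fun u => M * |t * deriv f u| + |t * (u * deriv f u - f u)|) (by fun_prop)
  refine ⟨C, fun x => ?_⟩
  have hmem := maxSet_subset_Icc hf hconv hmono hφmeas hφbdd ht x
    ((isCompact_maxSet hf hconv hmono hφmeas hφbdd ht x).sInf_mem
      (maxSet_nonempty hf hconv hmono hφmeas hφbdd ht x))
  have h1 := (le_abs_self _).trans (hC _ hmem)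
  change _ ≤ C at h1
  have h2 := abs_integral_sub_le_of_bounded hφmeas hφbdd x (x - t * deriv f (uPlus f φ x t))
  rw [sub_sub_cancel_left, abs_neg] at h2
  refine le_trans ?_ h1
  rw [hopfValue, hopfCost, add_sub_right_comm]
  exact (abs_add_le _ _).trans (add_le_add_left h2 _)

end

section

variable {ι : Type*} {l : Filter ι} [l.NeBot] {u v : ι → ℝ}

theorem limsup_le_limsup_of_tendsto_sub_zero (hu : IsBoundedUnder (· ≥ ·) l u)
    (hv : IsBoundedUnder (· ≤ ·) l v) (h : Tendsto (fun i => u i - v i) l (𝓝 0)) :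
    limsup u l ≤ limsup v l := by
  refine le_of_forall_pos_le_add fun ε hε => limsup_le_of_le hu.isCoboundedUnder_le ?_
  filter_upwards [h.eventually_lt_const (half_pos hε),
    eventually_lt_of_limsup_lt (b := limsup v l + ε / 2) (by linarith) hv] with i h1 h2
  linarith

theorem limsup_eq_limsup_of_tendsto_sub_zero {K : ℝ} (hu : ∀ i, |u i| ≤ K) (hv : ∀ i, |v i| ≤ K)
    (h : Tendsto (fun i => u i - v i) l (𝓝 0)) : limsup u l = limsup v l := by
  refine le_antisymm (limsup_le_limsup_of_tendsto_sub_zero ?_ ?_ h)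
    (limsup_le_limsup_of_tendsto_sub_zero ?_ ?_ (by simpa using h.neg))
  exacts [isBoundedUnder_of ⟨-K, fun i => (abs_le.1 (hu i)).1⟩,
    isBoundedUnder_of ⟨K, fun i => (abs_le.1 (hv i)).2⟩,
    isBoundedUnder_of ⟨-K, fun i => (abs_le.1 (hv i)).1⟩,
    isBoundedUnder_of ⟨K, fun i => (abs_le.1 (hu i)).2⟩]

theorem liminf_le_liminf_of_tendsto_sub_zero (hu : IsBoundedUnder (· ≥ ·) l u)
    (hv : IsBoundedUnder (· ≤ ·) l v) (h : Tendsto (fun i => u i - v i) l (𝓝 0)) :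
    liminf u l ≤ liminf v l := by
  refine le_of_forall_pos_le_add fun ε hε => sub_le_iff_le_add.1
    (le_liminf_of_le hv.isCoboundedUnder_ge ?_)
  filter_upwards [h.eventually_lt_const (half_pos hε),
    eventually_lt_of_lt_liminf (b := liminf u l - ε / 2) (by linarith) hu] with i h1 h2
  linarith

theorem liminf_eq_liminf_of_tendsto_sub_zero {K : ℝ} (hu : ∀ i, |u i| ≤ K) (hv : ∀ i, |v i| ≤ K)
    (h : Tendsto (fun i => u i - v i) l (𝓝 0)) : liminf u l = liminf v l := by
  refine le_antisymm (liminf_le_liminf_of_tendsto_sub_zero ?_ ?_ h)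
    (liminf_le_liminf_of_tendsto_sub_zero ?_ ?_ (by simpa using h.neg))
  exacts [isBoundedUnder_of ⟨-K, fun i => (abs_le.1 (hu i)).1⟩,
    isBoundedUnder_of ⟨K, fun i => (abs_le.1 (hv i)).2⟩,
    isBoundedUnder_of ⟨-K, fun i => (abs_le.1 (hv i)).1⟩,
    isBoundedUnder_of ⟨K, fun i => (abs_le.1 (hu i)).2⟩]

end

theorem abs_div_le_of_abs_le_mul {a x K : ℝ} (hK : 0 ≤ K) (h : |a| ≤ K * |x|) :
    |a / x| ≤ K := by
  rw [abs_div]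
  exact div_le_of_le_mul₀ (abs_nonneg x) hK h

theorem limsup_liminf_mean_maximizer_eq {f φ : ℝ → ℝ} {M t : ℝ} (hf : ContDiff ℝ 2 f)
    (hconv : ∀ u, 0 ≤ deriv (deriv f) u)
    (hmono : StrictMono (deriv f)) (hφmeas : Measurable φ) (hφbdd : ∀ x, |φ x| ≤ M)
    (ht : 0 < t) {w : ℝ → ℝ} (hw : ∀ x, w x ∈ maxSet f φ x t) {l : Filter ℝ} [l.NeBot]
    (hl : Tendsto (fun x : ℝ => x⁻¹) l (𝓝 0)) :
    limsup (fun x : ℝ => (∫ ξ in (0:ℝ)..x, w ξ) / x) l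
        = limsup (fun x : ℝ => (∫ ξ in (0:ℝ)..x, φ ξ) / x) l ∧
      liminf (fun x : ℝ => (∫ ξ in (0:ℝ)..x, w ξ) / x) l
        = liminf (fun x : ℝ => (∫ ξ in (0:ℝ)..x, φ ξ) / x) l := by
  have hM : 0 ≤ M := (abs_nonneg _).trans (hφbdd 0)
  simp only [integral_maximizer_eq_hopfValue_sub hf hconv hmono hφmeas hφbdd ht hw]
  have hu : ∀ x : ℝ, |(hopfValue f φ t x - hopfValue f φ t 0) / x| ≤ M := fun x => by
    have h := (hopfValue_lipschitz hf hconv hmono hφmeas hφbdd ht).dist_le_mul x 0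
    rw [Real.dist_eq, Real.dist_eq, sub_zero, Real.coe_toNNReal _ hM] at h
    exact abs_div_le_of_abs_le_mul hM h
  have hv : ∀ x : ℝ, |(∫ ξ in (0:ℝ)..x, φ ξ) / x| ≤ M := fun x => by
    have h := abs_integral_sub_le_of_bounded hφmeas hφbdd 0 x
    rw [intervalIntegral.integral_same, sub_zero, sub_zero] at h
    exact abs_div_le_of_abs_le_mul hM h
  obtain ⟨C, hC⟩ := exists_abs_hopfValue_sub_integral_le hf hconv hmono hφmeas hφbdd ht
  have hdiff : Tendsto (fun x : ℝ => (hopfValue f φ t x - hopfValue f φ t 0) / x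
      - (∫ ξ in (0:ℝ)..x, φ ξ) / x) l (𝓝 0) := by
    have hbdd : IsBoundedUnder (· ≤ ·) l (norm ∘ fun x =>
        hopfValue f φ t x - (∫ ξ in (0:ℝ)..x, φ ξ) - hopfValue f φ t 0) :=
      isBoundedUnder_of ⟨C + |hopfValue f φ t 0|, fun x =>
        (abs_sub _ _).trans (add_le_add_left (hC x) _)⟩
    refine (hl.zero_mul_isBoundedUnder_le hbdd).congr fun x => ?_
    ring
  exact ⟨limsup_eq_limsup_of_tendsto_sub_zero hu hv hdiff,
    liminf_eq_liminf_of_tendsto_sub_zero hu hv hdiff⟩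

/-- the four invariants of entropy solutions. -/
theorem stmt14_four_invariants
    (f φ : ℝ → ℝ) (M : ℝ)
    (hf : ContDiff ℝ 2 f)
    (hconv : ∀ u : ℝ, 0 ≤ deriv (deriv f) u)
    (hdeg : volume {u : ℝ | deriv (deriv f) u = 0} = 0)
    (hφmeas : Measurable φ)
    (hφbdd : ∀ x : ℝ, |φ x| ≤ M) :
    ∀ t : ℝ, 0 < t →
      (Filter.limsup (fun x : ℝ => (∫ ξ in (0:ℝ)..x, uPlus f φ ξ t) / x) Filter.atBot
        = Filter.limsup (fun x : ℝ => (∫ ξ in (0:ℝ)..x, φ ξ) / x) Filter.atBot) ∧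
      (Filter.liminf (fun x : ℝ => (∫ ξ in (0:ℝ)..x, uPlus f φ ξ t) / x) Filter.atBot
        = Filter.liminf (fun x : ℝ => (∫ ξ in (0:ℝ)..x, φ ξ) / x) Filter.atBot) ∧
      (Filter.limsup (fun x : ℝ => (∫ ξ in (0:ℝ)..x, uPlus f φ ξ t) / x) Filter.atTop
        = Filter.limsup (fun x : ℝ => (∫ ξ in (0:ℝ)..x, φ ξ) / x) Filter.atTop) ∧
      (Filter.liminf (fun x : ℝ => (∫ ξ in (0:ℝ)..x, uPlus f φ ξ t) / x) Filter.atTop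
        = Filter.liminf (fun x : ℝ => (∫ ξ in (0:ℝ)..x, φ ξ) / x) Filter.atTop) ∧
      (Filter.limsup (fun x : ℝ => (∫ ξ in (0:ℝ)..x, uMinus f φ ξ t) / x) Filter.atBot
        = Filter.limsup (fun x : ℝ => (∫ ξ in (0:ℝ)..x, φ ξ) / x) Filter.atBot) ∧
      (Filter.liminf (fun x : ℝ => (∫ ξ in (0:ℝ)..x, uMinus f φ ξ t) / x) Filter.atBot
        = Filter.liminf (fun x : ℝ => (∫ ξ in (0:ℝ)..x, φ ξ) / x) Filter.atBot) ∧
      (Filter.limsup (fun x : ℝ => (∫ ξ in (0:ℝ)..x, uMinus f φ ξ t) / x) Filter.atTop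
        = Filter.limsup (fun x : ℝ => (∫ ξ in (0:ℝ)..x, φ ξ) / x) Filter.atTop) ∧
      (Filter.liminf (fun x : ℝ => (∫ ξ in (0:ℝ)..x, uMinus f φ ξ t) / x) Filter.atTop
        = Filter.liminf (fun x : ℝ => (∫ ξ in (0:ℝ)..x, φ ξ) / x) Filter.atTop) := by
  intro t ht
  have hmono := strictMono_deriv_of_null_zeros hf hconv hdeg
  have hp : ∀ x, uPlus f φ x t ∈ maxSet f φ x t := fun x =>
    (isCompact_maxSet hf hconv hmono hφmeas hφbdd ht x).sInf_mem
      (maxSet_nonempty hf hconv hmono hφmeas hφbdd ht x)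
  have hm : ∀ x, uMinus f φ x t ∈ maxSet f φ x t := fun x =>
    (isCompact_maxSet hf hconv hmono hφmeas hφbdd ht x).sSup_mem
      (maxSet_nonempty hf hconv hmono hφmeas hφbdd ht x)
  have hpb := limsup_liminf_mean_maximizer_eq hf hconv hmono hφmeas hφbdd ht hp
    tendsto_inv_atBot_zero
  have hpt := limsup_liminf_mean_maximizer_eq hf hconv hmono hφmeas hφbdd ht hp
    tendsto_inv_atTop_zero
  have hmb := limsup_liminf_mean_maximizer_eq hf hconv hmono hφmeas hφbdd ht hm
    tendsto_inv_atBot_zero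
  have hmt := limsup_liminf_mean_maximizer_eq hf hconv hmono hφmeas hφbdd ht hm
    tendsto_inv_atTop_zero
  exact ⟨hpb.1, hpb.2, hpt.1, hpt.2, hmb.1, hmb.2, hmt.1, hmt.2⟩
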